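/- arXiv:1711.08909 — 3 statements merged into one kernel-verified Lean document; each statement's English description precedes it below -/
import Mathlib

section
/- Let W be a symmetric nonnegative N×N matrix with zero diagonal whose weighted graph is connected, let L_W be its Laplacian, and assume λ₂(L_W) is simple with unit eigenvector v. For nodes k ≠ l, there exist ε₀ > 0 and a differentiable function λ : (−ε₀, ε₀) → ℂ with λ(0) = λ₂(L_W) such that λ(ε) is an eigenvalue of L_W + ε L_{k→l} for every ε, and λ'(0) = s_{k→l} = v_l(v_l − v_k). In particular, if v_k = v_l then s_{k→l} = s_{l→k} = 0. -/
open Matrix Finset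

/-- The graph Laplacian `L_W = D_W - W`. -/
noncomputable def lapl {N : ℕ} (W : Matrix (Fin N) (Fin N) ℝ) : Matrix (Fin N) (Fin N) ℝ :=
  Matrix.diagonal (fun i => ∑ j, W i j) - W

/-- The second-smallest eigenvalue (spectral gap) of a symmetric matrix `L` with
`L·1 = 0`: the smallest eigenvalue possessing an eigenvector orthogonal to `1`. -/
noncomputable def lambda2 {N : ℕ} (L : Matrix (Fin N) (Fin N) ℝ) : ℝ :=
  sInf {r : ℝ | ∃ v : Fin N → ℝ, v ≠ 0 ∧ (∑ i, v i) = 0 ∧ L.mulVec v = r • v}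

/-- The underlying simple graph of a (symmetric) weight matrix: an edge `{i,j}` iff `W i j > 0`. -/
def graphOf {N : ℕ} (W : Matrix (Fin N) (Fin N) ℝ) : SimpleGraph (Fin N) :=
  SimpleGraph.fromRel (fun i j => 0 < W i j)

/-- The Laplacian `L_{k→l}` of the single directed link from node `k` to node `l`:
entries `(l,l) = 1`, `(l,k) = -1`, zero elsewhere. -/
noncomputable def Ldir {N : ℕ} (k l : Fin N) : Matrix (Fin N) (Fin N) ℝ :=
  lapl (Matrix.of fun i j => if i = l ∧ j = k then (1 : ℝ) else 0)

/-- First-order perturbation theory: if `μ` is an eigenvalue of `a` whose eigenspace is spanned by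
`x₀`, and `φ` is a left eigenvector with `φ x₀ = 1`, then `a + ε b` has a differentiable eigenvalue
branch through `μ` with derivative `φ (b x₀)`. -/
theorem exists_eigenvalue_branch {E : Type*} [NormedAddCommGroup E] [NormedSpace ℝ E]
    [FiniteDimensional ℝ E] (a b : E →L[ℝ] E) (φ : E →L[ℝ] ℝ) (x₀ : E) (μ : ℝ)
    (hx₀ : a x₀ = μ • x₀) (hφ : φ x₀ = 1) (hφa : ∀ x, φ (a x) = μ * φ x)
    (hker : ∀ x, a x = μ • x → ∃ c : ℝ, x = c • x₀) :
    ∃ f : ℝ → ℝ, f 0 = μ ∧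
      (∀ᶠ ε in nhds (0 : ℝ), DifferentiableAt ℝ f ε ∧ ∃ x, x ≠ 0 ∧ a x + ε • b x = f ε • x) ∧
      HasDerivAt f (φ (b x₀)) 0 := by
  have : CompleteSpace E := FiniteDimensional.complete ℝ E
  let G : ℝ × E × ℝ → ℝ × E × ℝ := fun p =>
    (p.1, a p.2.1 + p.1 • b p.2.1 - p.2.2 • p.2.1, φ p.2.1 - 1)
  let e1 : ℝ × E × ℝ →L[ℝ] ℝ := .fst ℝ ℝ (E × ℝ)
  let e2 : ℝ × E × ℝ →L[ℝ] E := (ContinuousLinearMap.fst ℝ E ℝ).comp (.snd ℝ ℝ (E × ℝ))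
  let e3 : ℝ × E × ℝ →L[ℝ] ℝ := (ContinuousLinearMap.snd ℝ E ℝ).comp (.snd ℝ ℝ (E × ℝ))
  have hG : ContDiffAt ℝ 1 G (0, x₀, μ) := by
    apply ContDiff.contDiffAt
    fun_prop
  let G' : ℝ × E × ℝ →L[ℝ] ℝ × E × ℝ :=
    e1.prod ((a.comp e2 + ((0 : ℝ) • b.comp e2 + e1.smulRight (b x₀)) -
      (μ • e2 + e3.smulRight x₀)).prod (φ.comp e2))
  have hG' : HasFDerivAt G G' (0, x₀, μ) := by
    have h1 : HasFDerivAt (fun p : ℝ × E × ℝ => p.1) e1 (0, x₀, μ) := e1.hasFDerivAt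
    have h2 : HasFDerivAt (fun p : ℝ × E × ℝ => p.2.1) e2 (0, x₀, μ) := e2.hasFDerivAt
    have h3 : HasFDerivAt (fun p : ℝ × E × ℝ => p.2.2) e3 (0, x₀, μ) := e3.hasFDerivAt
    have ha := a.hasFDerivAt.comp (0, x₀, μ) h2
    have hb := b.hasFDerivAt.comp (0, x₀, μ) h2
    have hp := φ.hasFDerivAt.comp (0, x₀, μ) h2
    exact h1.prodMk (((ha.add (h1.smul hb)).sub (h3.smul h2)).prodMk (hp.sub_const 1))
  have hinj : Function.Injective (G' : ℝ × E × ℝ →ₗ[ℝ] ℝ × E × ℝ) := by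
    rw [injective_iff_map_eq_zero]
    rintro ⟨ε, y, τ⟩ h
    simp only [ContinuousLinearMap.coe_coe, Prod.ext_iff] at h
    obtain ⟨h1, h2, h3⟩ := h
    replace h1 : ε = 0 := h1
    subst h1
    replace h2 : a y + ((0 : ℝ) • b y + (0 : ℝ) • b x₀) - (μ • y + τ • x₀) = 0 := h2
    replace h3 : φ y = 0 := h3
    have hτ : τ = 0 := by
      have := congrArg φ h2
      simpa [hφa, h3, hφ] using this
    subst hτ
    obtain ⟨c, rfl⟩ := hker y (by simpa [sub_eq_zero] using h2)
    have hc : c = 0 := by simpa [hφ] using h3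
    simp [hc]
  let e : (ℝ × E × ℝ) ≃L[ℝ] (ℝ × E × ℝ) :=
    (LinearEquiv.ofInjectiveEndo (G' : ℝ × E × ℝ →ₗ[ℝ] ℝ × E × ℝ) hinj).toContinuousLinearEquiv
  have he : HasFDerivAt G (e : ℝ × E × ℝ →L[ℝ] ℝ × E × ℝ) (0, x₀, μ) := by
    exact hG'.congr_fderiv (ContinuousLinearMap.ext fun _ => rfl)
  have hG0 : G (0, x₀, μ) = (0, 0, 0) := by simp [G, hx₀, hφ]
  let g := hG.localInverse he one_ne_zero
  have hg0 : g (0, 0, 0) = (0, x₀, μ) := by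
    rw [← hG0]; exact hG.localInverse_apply_image he one_ne_zero
  have hg : ContDiffAt ℝ 1 g (0, 0, 0) := by
    rw [← hG0]; exact hG.to_localInverse he one_ne_zero
  have hGg : ∀ᶠ p in nhds ((0 : ℝ), (0 : E), (0 : ℝ)), G (g p) = p := by
    rw [← hG0]
    exact (hG.hasStrictFDerivAt' he one_ne_zero).eventually_right_inverse
  let γ : ℝ → ℝ × E × ℝ := fun ε => g (ε, 0, 0)
  have hι : ContDiff ℝ 1 (fun ε : ℝ => (ε, (0 : E), (0 : ℝ))) := by fun_prop
  have hγ : ContDiffAt ℝ 1 γ 0 := ContDiffAt.comp (0 : ℝ) hg hι.contDiffAt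
  have hsol : ∀ᶠ ε in nhds (0 : ℝ), φ (γ ε).2.1 = 1 ∧
      a (γ ε).2.1 + ε • b (γ ε).2.1 = (γ ε).2.2 • (γ ε).2.1 := by
    filter_upwards [hι.continuous.continuousAt.eventually hGg] with ε hε
    have h1 : (γ ε).1 = ε := congrArg Prod.fst hε
    have h2 : a (γ ε).2.1 + (γ ε).1 • b (γ ε).2.1 - (γ ε).2.2 • (γ ε).2.1 = 0 :=
      congrArg (fun p => p.2.1) hε
    have h3 : φ (γ ε).2.1 - 1 = 0 := congrArg (fun p => p.2.2) hε
    rw [h1] at h2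
    exact ⟨sub_eq_zero.mp h3, sub_eq_zero.mp h2⟩
  have hγ0 : γ 0 = (0, x₀, μ) := hg0
  refine ⟨fun ε => (γ ε).2.2, by simp [hγ0], ?_, ?_⟩
  · filter_upwards [hγ.eventually (by simp), hsol] with ε hd hs
    refine ⟨(hd.differentiableAt one_ne_zero).snd.snd, (γ ε).2.1, fun h0 => ?_, hs.2⟩
    simp [h0] at hs
  · have hformula : (fun ε => (γ ε).2.2) =ᶠ[nhds 0] fun ε => μ + ε * φ (b (γ ε).2.1) := by
      filter_upwards [hsol] with ε hs
      have := congrArg φ hs.2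
      simpa [hφa, hs.1] using this.symm
    have hx : DifferentiableAt ℝ (fun ε => φ (b (γ ε).2.1)) 0 :=
      φ.differentiableAt.comp (0 : ℝ)
        (b.differentiableAt.comp (0 : ℝ) (hγ.differentiableAt one_ne_zero).snd.fst)
    have hd := ((hasDerivAt_id (0 : ℝ)).mul hx.hasDerivAt).const_add μ
    refine HasDerivAt.congr_of_eventuallyEq ?_ hformula
    have h0 : b (γ 0).2.1 = b x₀ := by rw [hγ0]
    simpa only [one_mul, id, zero_mul, add_zero, h0] using! hd

theorem lapl_isSymm {N : ℕ} {W : Matrix (Fin N) (Fin N) ℝ} (hW : W.IsSymm) :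
    (lapl W).IsSymm :=
  (Matrix.isSymm_diagonal _).sub hW

theorem Ldir_mulVec {N : ℕ} {k l : Fin N} (x : Fin N → ℝ) :
    (Ldir k l).mulVec x = Pi.single l (x l - x k) := by
  ext i
  by_cases hi : i = l
  · subst hi
    rw [Ldir, lapl, sub_mulVec, Pi.sub_apply, mulVec_diagonal]
    simp [mulVec, dotProduct, -Finset.sum_boole]
  · rw [Ldir, lapl, sub_mulVec, Pi.sub_apply, mulVec_diagonal]
    simp [mulVec, dotProduct, hi]

/-- for a connected weighted undirected graph with simple spectral gap and
Fiedler vector `v`, there is a differentiable complex eigenvalue branch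
`λ(ε)` of `L_W + ε L_{k→l}` through `λ₂` with `λ'(0) = s_{k→l} = v l (v l - v k)`;
in particular if `v k = v l` then `s_{k→l} = s_{l→k} = 0`. -/
theorem stmt2 {N : ℕ} (W : Matrix (Fin N) (Fin N) ℝ)
    (hWsymm : W.IsSymm) (hWnn : ∀ i j, 0 ≤ W i j) (hWdiag : ∀ i, W i i = 0)
    (hconn : (graphOf W).Connected)
    (v : Fin N → ℝ)
    (hv : (lapl W).mulVec v = lambda2 (lapl W) • v)
    (hvunit : ∑ i, (v i) ^ 2 = 1)
    (hsimple : ∀ u : Fin N → ℝ, (lapl W).mulVec u = lambda2 (lapl W) • u → ∃ c : ℝ, u = c • v)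
    (k l : Fin N) (hkl : k ≠ l) :
    (∃ ε₀ : ℝ, 0 < ε₀ ∧ ∃ f : ℝ → ℂ,
      f 0 = (lambda2 (lapl W) : ℂ) ∧
      (∀ ε ∈ Set.Ioo (-ε₀) ε₀, DifferentiableAt ℝ f ε ∧
        ∃ u : Fin N → ℂ, u ≠ 0 ∧
          ((lapl W + ε • Ldir k l).map Complex.ofReal).mulVec u = f ε • u) ∧
      HasDerivAt f ((v l * (v l - v k) : ℝ) : ℂ) 0) ∧
      (v k = v l → v l * (v l - v k) = 0 ∧ v k * (v k - v l) = 0) := by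
  refine ⟨?_, fun h => by simp [h]⟩
  let φ : (Fin N → ℝ) →L[ℝ] ℝ := LinearMap.toContinuousLinearMap (dotProductBilin ℝ ℝ v)
  obtain ⟨f, hf0, hev, hder⟩ := exists_eigenvalue_branch
    (LinearMap.toContinuousLinearMap (lapl W).mulVecLin)
    (LinearMap.toContinuousLinearMap (Ldir k l).mulVecLin) φ v (lambda2 (lapl W)) hv
    (by
      change v ⬝ᵥ v = 1
      simpa [dotProduct, sq] using hvunit)
    (fun x => by
      change v ⬝ᵥ (lapl W).mulVec x = lambda2 (lapl W) * (v ⬝ᵥ x)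
      rw [dotProduct_mulVec, ← mulVec_transpose, lapl_isSymm hWsymm, hv, smul_dotProduct,
        smul_eq_mul])
    hsimple
  have hφ : φ ((Ldir k l).mulVec v) = v l * (v l - v k) := by
    change v ⬝ᵥ (Ldir k l).mulVec v = _
    rw [Ldir_mulVec, dotProduct_single]
  obtain ⟨ε₀, hε₀, hball⟩ := Metric.eventually_nhds_iff.mp hev
  refine ⟨ε₀, hε₀, fun ε => (f ε : ℂ), by simp [hf0], fun ε hε => ?_, ?_⟩
  · obtain ⟨hd, x, hx, hxe⟩ := hball (y := ε) (by simpa [Real.dist_eq, abs_lt] using hε)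
    refine ⟨hd.hasDerivAt.ofReal_comp.differentiableAt, fun i => (x i : ℂ), fun h => hx ?_, ?_⟩
    · ext i
      exact Complex.ofReal_eq_zero.mp (congrFun h i)
    · have hxe' : (lapl W + ε • Ldir k l).mulVec x = f ε • x := by
        rw [add_mulVec, smul_mulVec]
        exact hxe
      ext i
      have := (RingHom.map_mulVec Complex.ofRealHom (lapl W + ε • Ldir k l) x i).symm
      rw [hxe'] at this
      simpa using! this
  · rw [← hφ]
    exact hder.ofReal_comp
end

section
/- Let G be a connected unweighted undirected graph on N nodes given by a symmetric 0–1 adjacency matrix W with zero diagonal, with Laplacian L_W, and assume λ₂(L_W) is simple with Fiedler vector v. Suppose nodes k ≠ l have the same set of adjacent nodes, i.e. W_{ki} = W_{li} for all i, and that the degree d_k satisfies d_k > d_min, where d_min is the minimal degree in G. Then v_k = v_l; consequently s_{kl} = (v_k − v_l)² = 0 and s_{k→l} = s_{l→k} = 0, i.e. adding a link between k and l (directed in either way or undirected) leaves the spectral gap invariant at first order. -/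
open Matrix Finset

lemma lapl_mulVec_apply {N : ℕ} (W : Matrix (Fin N) (Fin N) ℝ) (x : Fin N → ℝ) (i : Fin N) :
    (lapl W).mulVec x i = (∑ j, W i j) * x i - ∑ j, W i j * x j := by
  rw [lapl, Matrix.sub_mulVec, Pi.sub_apply, Matrix.mulVec_diagonal]
  rfl

lemma sum_lapl_mulVec {N : ℕ} {W : Matrix (Fin N) (Fin N) ℝ} (hW : W.IsSymm) (x : Fin N → ℝ) :
    ∑ i, (lapl W).mulVec x i = 0 := by
  simp only [lapl_mulVec_apply, Finset.sum_sub_distrib, Finset.sum_mul]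
  rw [sub_eq_zero, Finset.sum_comm]
  exact Finset.sum_congr rfl fun i _ => Finset.sum_congr rfl fun j _ => by rw [hW.apply]

lemma lambda2_le {N : ℕ} {L : Matrix (Fin N) (Fin N) ℝ} {x : Fin N → ℝ} {r : ℝ} (hx : x ≠ 0)
    (hsum : ∑ i, x i = 0) (h : L.mulVec x = r • x) : lambda2 L ≤ r := by
  refine csInf_le (Set.Finite.bddBelow ?_) ⟨x, hx, hsum, h⟩
  refine (Module.End.finite_hasEigenvalue (Matrix.toLin' L)).subset ?_
  rintro s ⟨y, hy, -, hLy⟩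
  exact Module.End.hasEigenvalue_of_hasEigenvector
    (Module.End.hasEigenvector_iff.2 ⟨Module.End.mem_eigenspace_iff.2 (by simpa using hLy), hy⟩)

/-- The shifted Laplacian `L + (λ₂ / N) J - λ₂ I`, with `J` the all-ones matrix, is positive
semidefinite. -/
lemma posSemidef_lapl_shift {N : ℕ} {W : Matrix (Fin N) (Fin N) ℝ} (hW : W.IsSymm) :
    (lapl W + Matrix.of (fun _ _ => lambda2 (lapl W) / N)
      - Matrix.diagonal (fun _ => lambda2 (lapl W))).PosSemidef := by
  set m := lambda2 (lapl W)
  set A := lapl W + Matrix.of (fun _ _ => m / N) - Matrix.diagonal (fun _ => m) with hA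
  have hmul (x : Fin N → ℝ) (i : Fin N) :
      A.mulVec x i = (lapl W).mulVec x i + m / N * ∑ j, x j - m * x i := by
    rw [hA, Matrix.sub_mulVec, Matrix.add_mulVec, Pi.sub_apply, Pi.add_apply,
      Matrix.mulVec_diagonal, Finset.mul_sum]
    rfl
  have hherm : A.IsHermitian := by
    ext i j
    by_cases hij : i = j
    · simp [hij]
    · simp [hA, lapl, hij, Ne.symm hij, hW.apply i j]
  rw [hherm.posSemidef_iff_eigenvalues_nonneg]
  intro i
  set μ := hherm.eigenvalues i
  set x : Fin N → ℝ := ⇑(hherm.eigenvectorBasis i)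
  have hAx : A.mulVec x = μ • x := hherm.mulVec_eigenvectorBasis i
  have hx0 : x ≠ 0 := fun h => hherm.eigenvectorBasis.orthonormal.ne_zero i
    (by ext j; exact congrFun h j)
  have hN : (N : ℝ) ≠ 0 := Nat.cast_ne_zero.2 (Fin.pos i).ne'
  by_cases hs : ∑ j, x j = 0
  · have : m ≤ μ + m := lambda2_le hx0 hs <| by
      ext j
      have := congrFun hAx j
      rw [hmul, hs, Pi.smul_apply, smul_eq_mul] at this
      rw [Pi.smul_apply, smul_eq_mul]
      linarith
    simpa using this
  · have h : ∑ j, A.mulVec x j = μ * ∑ j, x j := by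
      rw [hAx, Finset.mul_sum]
      rfl
    simp only [hmul, Finset.sum_sub_distrib, Finset.sum_add_distrib, sum_lapl_mulVec hW,
      Finset.sum_const, Finset.card_univ, Fintype.card_fin, nsmul_eq_mul, ← Finset.mul_sum] at h
    have h' : μ * ∑ j, x j = 0 := by
      rw [← h]
      field_simp
      ring
    exact ((mul_eq_zero.1 h').resolve_right hs).ge

/-- Fiedler's bound of the spectral gap by the degrees. -/
lemma lambda2_sub_le {N : ℕ} {W : Matrix (Fin N) (Fin N) ℝ} (hW : W.IsSymm)
    (hdiag : ∀ i, W i i = 0) (i : Fin N) :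
    lambda2 (lapl W) - ∑ j, W i j ≤ lambda2 (lapl W) / N := by
  have h := (posSemidef_lapl_shift hW).diag_nonneg (i := i)
  have hL : lapl W i i = ∑ j, W i j := by simp [lapl, hdiag]
  simp only [Matrix.sub_apply, Matrix.add_apply, Matrix.of_apply, Matrix.diagonal_apply_eq,
    hL] at h
  linarith

/-- in a connected unweighted graph, if two nodes `k ≠ l` have the same
set of adjacent nodes and the degree of `k` is strictly larger than the minimal degree
(i.e. some node has strictly smaller degree), then the Fiedler vector satisfies
`v k = v l`; consequently `s_{kl} = (v k - v l)² = 0` and `s_{k→l} = s_{l→k} = 0`. -/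
theorem stmt8 {N : ℕ} (W : Matrix (Fin N) (Fin N) ℝ)
    (hWsymm : W.IsSymm) (h01 : ∀ i j, W i j = 0 ∨ W i j = 1) (hWdiag : ∀ i, W i i = 0)
    (hconn : (graphOf W).Connected)
    (v : Fin N → ℝ)
    (hv : (lapl W).mulVec v = lambda2 (lapl W) • v)
    (hvunit : ∑ i, (v i) ^ 2 = 1)
    (hsimple : ∀ u : Fin N → ℝ, (lapl W).mulVec u = lambda2 (lapl W) • u → ∃ c : ℝ, u = c • v)
    (k l : Fin N) (hkl : k ≠ l)
    (hsame : ∀ i, W k i = W l i)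
    (hdeg : ∃ i, ∑ j, W i j < ∑ j, W k j) :
    v k = v l ∧ (v k - v l) ^ 2 = 0 ∧
      v l * (v l - v k) = 0 ∧ v k * (v k - v l) = 0 := by
  have hvkl : v k = v l := by
    by_contra hne
    have hlam : lambda2 (lapl W) = ∑ j, W k j := by
      have hk := congrFun hv k
      have hl := congrFun hv l
      simp only [lapl_mulVec_apply, Pi.smul_apply, smul_eq_mul, ← hsame] at hk hl
      refine mul_right_cancel₀ (sub_ne_zero.2 hne) ?_
      linarith
    obtain ⟨i, hi⟩ := hdeg
    have hbound := lambda2_sub_le hWsymm hWdiag i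
    rw [hlam] at hbound
    have hgap : ∑ j, W i j + 1 ≤ ∑ j, W k j := by
      choose n hn using fun a b => show ∃ n : ℕ, W a b = n from
        (h01 a b).elim (fun h => ⟨0, by simpa using h⟩) (fun h => ⟨1, by simpa using h⟩)
      simp only [hn] at hi ⊢
      exact_mod_cast hi
    have hlt : ∑ j, W k j < N := by
      have : ∑ j, W k j < ∑ _j : Fin N, (1 : ℝ) :=
        Finset.sum_lt_sum (fun j _ => by rcases h01 k j with h | h <;> simp [h])
          ⟨k, Finset.mem_univ k, by simp [hWdiag]⟩
      simpa using this
    have hN : (0 : ℝ) < N := Nat.cast_pos.2 (Fin.pos k)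
    have := (div_lt_one hN).2 hlt
    linarith
  simp [hvkl]
end

section
/- Let L₁ ∈ ℝ^{n×n} satisfy L₁·1 = 0 with 0 a simple eigenvalue, every nonzero eigenvalue of L₁ having positive real part, and L₁ diagonalizable over ℂ. Then there exist an index k₀ ∈ {1,…,n} and a constant δ > 0 such that for every λ with 0 < λ < δ, the vector −(L₁ − λI)^{−1}e_{k₀} has all entries strictly positive, where e_{k₀} is the k₀-th standard basis vector of ℝⁿ. -/
open Matrix Finset

lemma det_smul_one_sub {n R : Type*} [Fintype n] [DecidableEq n] [CommRing R] {A : Matrix n n R}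
    {q : Polynomial R} (hq : A.charpoly = Polynomial.X * q) (t : R) :
    (t • (1 : Matrix n n R) - A).det = t * q.eval t := by
  rw [smul_one_eq_diagonal]
  change (scalar n t - A).det = _
  rw [← eval_charpoly, hq, Polynomial.eval_mul, Polynomial.eval_X]

/-- If `A` has zero row sums, its characteristic polynomial has the form `X * q`, and the row sums
of the adjugate of `t - A` all equal `q(t)`. -/
lemma adjugate_scalar_sub_mulVec_one {n : Type*} [Fintype n] [DecidableEq n] {A : Matrix n n ℝ}
    (hA : A *ᵥ (fun _ => 1) = 0) {q : Polynomial ℝ} (hq : A.charpoly = Polynomial.X * q) (t : ℝ) :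
    (t • (1 : Matrix n n ℝ) - A).adjugate *ᵥ (fun _ => 1) = fun _ => q.eval t := by
  have hcont : Continuous fun t : ℝ =>
      (t • (1 : Matrix n n ℝ) - A).adjugate *ᵥ (fun _ => (1 : ℝ)) := by
    fun_prop
  refine congrFun (hcont.ext_on (dense_compl_singleton (0 : ℝ))
    (continuous_pi fun _ => q.continuous) ?_) t
  intro s hs
  have hs : s ≠ 0 := hs
  have hmul : (s • (1 : Matrix n n ℝ) - A) *ᵥ (fun _ => 1) = s • (fun _ => (1 : ℝ)) := by
    rw [sub_mulVec, hA, smul_mulVec, one_mulVec, sub_zero]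
  have h := congrArg ((s • (1 : Matrix n n ℝ) - A).adjugate *ᵥ ·) hmul
  simp only [mulVec_mulVec, adjugate_mul, mulVec_smul, det_smul_one_sub hq, smul_mulVec, one_mulVec] at h
  ext i
  have hi := congrFun h i
  simp only [Pi.smul_apply, smul_eq_mul, mul_one] at hi
  exact (mul_left_cancel₀ hs hi).symm

/-- If `0` is a simple root of the characteristic polynomial of `A`, then the kernel of `A` is
spanned by any nonzero vector in it. -/
lemma exists_smul_eq_of_mulVec_eq_zero {n K : Type*} [Fintype n] [DecidableEq n] [Field K]
    {A : Matrix n n K} (h : Polynomial.rootMultiplicity 0 A.charpoly = 1) {v w : n → K}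
    (hv : A *ᵥ v = 0) (hv0 : v ≠ 0) (hw : A *ᵥ w = 0) : ∃ c : K, c • v = w := by
  have hle := LinearMap.finrank_eigenspace_le (toLin' A) 0
  rw [charpoly_toLin', h] at hle
  obtain ⟨u, hu⟩ := finrank_le_one_iff.mp hle
  have mem : ∀ x : n → K, A *ᵥ x = 0 → x ∈ Module.End.eigenspace (toLin' A) 0 := fun x hx => by
    rw [Module.End.mem_eigenspace_iff, toLin'_apply, hx, zero_smul]
  obtain ⟨a, ha⟩ := hu ⟨v, mem v hv⟩
  obtain ⟨b, hb⟩ := hu ⟨w, mem w hw⟩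
  have ha : a • (u : n → K) = v := congrArg Subtype.val ha
  have hb : b • (u : n → K) = w := congrArg Subtype.val hb
  have ha0 : a ≠ 0 := by
    rintro rfl
    exact hv0 (by rw [← ha, zero_smul])
  exact ⟨b * a⁻¹, by rw [← ha, ← hb, smul_smul, inv_mul_cancel_right₀ ha0]⟩

/-- if `L₁ ∈ ℝⁿˣⁿ` satisfies `L₁·1 = 0` with `0` a simple eigenvalue,
every nonzero eigenvalue of `L₁` has positive real part, and `L₁` is diagonalizable
over `ℂ`, then there are an index `k₀` and a `δ > 0` such that for every
`0 < λ < δ`, the vector `-(L₁ - λI)⁻¹ e_{k₀}` has all entries strictly positive. -/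
theorem stmt14 {n : ℕ} (L₁ : Matrix (Fin n) (Fin n) ℝ)
    (hrow : L₁.mulVec (fun _ => 1) = 0)
    (h0simple : Polynomial.rootMultiplicity 0 L₁.charpoly = 1)
    (hpos : ∀ z : ℂ, z ∈ spectrum ℂ (L₁.map Complex.ofReal) → z ≠ 0 → 0 < z.re)
    (hdiag : ∃ (P : Matrix (Fin n) (Fin n) ℂ) (d : Fin n → ℂ),
      IsUnit P.det ∧ L₁.map Complex.ofReal = P * Matrix.diagonal d * P⁻¹) :
    ∃ k₀ : Fin n, ∃ δ : ℝ, 0 < δ ∧ ∀ lam : ℝ, 0 < lam → lam < δ →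
      ∀ i : Fin n,
        0 < (-((L₁ - lam • (1 : Matrix (Fin n) (Fin n) ℝ))⁻¹.mulVec (Pi.single k₀ 1))) i := by
  have hne : L₁.charpoly ≠ 0 := L₁.charpoly_monic.ne_zero
  obtain ⟨q, hq, hq0⟩ := Polynomial.exists_eq_pow_rootMultiplicity_mul_and_not_dvd _ hne 0
  rw [h0simple, pow_one, Polynomial.C_0, sub_zero] at hq
  rw [Polynomial.dvd_iff_isRoot, Polynomial.IsRoot.def] at hq0
  have hdet := det_smul_one_sub hq
  set B : ℝ → Matrix (Fin n) (Fin n) ℝ :=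
    fun t => (t • (1 : Matrix (Fin n) (Fin n) ℝ) - L₁).adjugate
    with hB
  have hsum : ∀ i, ∑ k, B 0 i k = q.eval 0 := fun i => by
    simpa [hB, mulVec, dotProduct] using congrFun (adjugate_scalar_sub_mulVec_one hrow hq 0) i
  have hmul : L₁ * B 0 = 0 := by
    have h := mul_adjugate ((0 : ℝ) • (1 : Matrix (Fin n) (Fin n) ℝ) - L₁)
    rw [hdet, zero_mul, zero_smul] at h
    simpa [hB] using h
  have hn : Nonempty (Fin n) := by
    by_contra hemp
    rw [not_nonempty_iff] at hemp
    rw [charpoly, det_isEmpty, ← Polynomial.C_1, Polynomial.rootMultiplicity_C] at h0simple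
    exact zero_ne_one h0simple
  have hone : (fun _ : Fin n => (1 : ℝ)) ≠ 0 := fun h => one_ne_zero (congrFun h hn.some)
  have hcol : ∀ k, ∃ c : ℝ, ∀ i, B 0 i k = c := fun k => by
    obtain ⟨c, hc⟩ := exists_smul_eq_of_mulVec_eq_zero (w := fun i => B 0 i k) h0simple hrow hone
      (funext fun i => congrFun (congrFun hmul i) k)
    exact ⟨c, fun i => by simpa using (congrFun hc i).symm⟩
  choose c hc using hcol
  obtain ⟨k, -, hk⟩ : ∃ k ∈ univ, 0 < c k * q.eval 0 := by
    refine exists_lt_of_sum_lt (f := fun _ => (0 : ℝ)) ?_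
    have h := hsum hn.some
    simp only [hc] at h
    rw [sum_const_zero, ← sum_mul, h]
    exact mul_self_pos.mpr hq0
  have hev : ∀ᶠ t in nhds (0 : ℝ), ∀ i, 0 < B t i k * q.eval t := by
    rw [Filter.eventually_all]
    intro i
    have hcont : Continuous fun t : ℝ => B t i k * q.eval t := by
      refine Continuous.mul (Continuous.matrix_elem ?_ i k) q.continuous
      fun_prop
    exact hcont.continuousAt.eventually_const_lt (by simpa only [hc] using hk)
  obtain ⟨δ, hδ, hball⟩ := Metric.eventually_nhds_iff.mp hev
  refine ⟨k, δ, hδ, fun t ht htδ i => ?_⟩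
  have hpos' := hball (y := t) (by rwa [Real.dist_eq, sub_zero, abs_of_pos ht]) i
  have hqt : q.eval t ≠ 0 := right_ne_zero_of_mul hpos'.ne'
  have hinv : -(L₁ - t • (1 : Matrix (Fin n) (Fin n) ℝ))⁻¹ = (t * q.eval t)⁻¹ • B t := by
    have h : (L₁ - t • (1 : Matrix (Fin n) (Fin n) ℝ)) * -((t * q.eval t)⁻¹ • B t) = 1 := by
      rw [mul_neg, ← neg_mul, neg_sub, mul_smul_comm, hB, mul_adjugate, hdet, smul_smul,
        inv_mul_cancel₀ (mul_ne_zero ht.ne' hqt), one_smul]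
    rw [inv_eq_right_inv h, neg_neg]
  rw [← neg_mulVec, hinv, mulVec_single_one, col_apply, Matrix.smul_apply, smul_eq_mul]
  have heq : (t * q.eval t)⁻¹ * B t i k = t⁻¹ * (B t i k * q.eval t) / (q.eval t) ^ 2 := by
    field_simp
  rw [heq]
  positivity
end
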